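/- Let Λ be the exterior algebra of an n-dimensional k-vector space with basis e₁,…,e_n, and let Rad(Λ) = Λ^{≥1} be its augmentation ideal. For i ≥ 0, let M = Rad^i(Λ)/Rad^{i+2}(Λ), made into an A-module by letting each generator x_t act as left exterior multiplication by e_t (this is well defined: any product of two of the e's maps Rad^i(Λ) into Rad^{i+2}(Λ), so the operators commute on M and have vanishing p-th power). Then M has constant r-radical type and constant r-socle type for every 1 ≤ r ≤ n: for any two r-dimensional subspaces U, U′ ⊆ span_k(x₁,…,x_n) and every ℓ ≥ 1, dim_k Rad^ℓ_U(M) = dim_k Rad^ℓ_{U′}(M) and dim_k Soc^ℓ_U(M) = dim_k Soc^ℓ_{U′}(M). -/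

import Mathlib

open scoped TensorProduct

set_option synthInstance.maxHeartbeats 1000000
set_option maxHeartbeats 1000000

noncomputable section

def truncIdeal (k : Type*) [Field k] (n p : ℕ) : Ideal (MvPolynomial (Fin n) k) :=
  Ideal.span (Set.range fun i : Fin n => (MvPolynomial.X i : MvPolynomial (Fin n) k) ^ p)

abbrev TruncAlg (k : Type*) [Field k] (n p : ℕ) :=
  MvPolynomial (Fin n) k ⧸ truncIdeal k n p

def xGen (k : Type*) [Field k] (n p : ℕ) (i : Fin n) : TruncAlg k n p :=
  Ideal.Quotient.mk (truncIdeal k n p) (MvPolynomial.X i)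

def radIdeal (k : Type*) [Field k] (n p : ℕ) : Ideal (TruncAlg k n p) :=
  Ideal.span (Set.range (xGen k n p))

def xSpan (k : Type*) [Field k] (n p : ℕ) : Submodule k (TruncAlg k n p) :=
  Submodule.span k (Set.range (xGen k n p))

def IsFreeVia {C A : Type*} [CommRing C] [CommRing A] (α : C →+* A)
    (M : Type*) [AddCommGroup M] [Module A M] : Prop :=
  letI : Module C M := Module.compHom M α
  Module.Free C M

def smulLinear (k : Type*) {A : Type*} (M : Type*) [CommSemiring k] [Semiring A]
    [AddCommMonoid M] [Module k M] [Module A M] [SMulCommClass k A M] (a : A) :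
    M →ₗ[k] M where
  toFun m := a • m
  map_add' x y := smul_add a x y
  map_smul' c m := (smul_comm c a m).symm

def radPow (k A M : Type*) [CommSemiring k] [CommRing A] [AddCommMonoid M]
    [Module k M] [Module A M] [SMulCommClass k A M] (U : Set A) (j : ℕ) :
    Submodule k M :=
  ⨆ (u : Fin j → A) (_ : ∀ i, u i ∈ U), LinearMap.range (smulLinear k M (∏ i, u i))

def socPow (k A M : Type*) [CommSemiring k] [CommRing A] [AddCommMonoid M]
    [Module k M] [Module A M] [SMulCommClass k A M] (U : Set A) (j : ℕ) :
    Submodule k M :=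
  ⨅ (u : Fin j → A) (_ : ∀ i, u i ∈ U), LinearMap.ker (smulLinear k M (∏ i, u i))

/-- `Rad(Λ) = Λ^{≥1}`: the two-sided augmentation ideal of the exterior algebra on
`kⁿ`, as a `k`-submodule. -/
def extRad (k : Type*) [Field k] (n : ℕ) :
    Submodule k (ExteriorAlgebra k (Fin n → k)) :=
  ⊤ * LinearMap.range
      (ExteriorAlgebra.ι k : (Fin n → k) →ₗ[k] ExteriorAlgebra k (Fin n → k)) * ⊤

/-- The subquotient `Rad^i(Λ)/Rad^{i+2}(Λ)` as a `k`-module. -/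
abbrev ExtQuot (k : Type*) [Field k] (n i : ℕ) : Type _ :=
  ↥((extRad k n) ^ i) ⧸
    (Submodule.comap ((extRad k n) ^ i).subtype ((extRad k n) ^ (i + 2)))

/-- The quotient projection `Rad^i(Λ) → Rad^i(Λ)/Rad^{i+2}(Λ)`. -/
def extProj (k : Type*) [Field k] (n i : ℕ) :
    ↥((extRad k n) ^ i) →ₗ[k] ExtQuot k n i :=
  Submodule.mkQ _

section Helpers

variable {k : Type*} [Field k]

section Intertwining

variable {A M : Type*} [CommRing A] [AddCommGroup M] [Module k M] [Module A M]

theorem smul_eq_zero_of_pow_eq_zero [SMulCommClass k A M] {a : A} {j : ℕ} (ha : a ^ j = 0)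
    {m : M} (hm : ∃ c : k, a • m = c • m) : a • m = 0 := by
  obtain ⟨c, hc⟩ := hm
  have hpow : ∀ j : ℕ, a ^ j • m = c ^ j • m := by
    intro j
    induction j with
    | zero => simp
    | succ j ih => rw [pow_succ', mul_smul, ih, ← smul_comm, hc, smul_smul, pow_succ]
  have h0 := hpow j
  rw [ha, zero_smul] at h0
  rcases smul_eq_zero.1 h0.symm with h | h
  · rw [hc, eq_zero_of_pow_eq_zero h, zero_smul]
  · rw [h, smul_zero]

theorem prod_smul_intertwine (Φ : M →ₗ[k] M) {j : ℕ} (u u' : Fin j → A)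
    (h : ∀ i m, Φ (u i • m) = u' i • Φ m) (m : M) :
    Φ ((∏ i, u i) • m) = (∏ i, u' i) • Φ m := by
  induction j generalizing m with
  | zero => simp
  | succ j ih =>
    rw [Fin.prod_univ_succ, Fin.prod_univ_succ, mul_smul, mul_smul, h,
      ih _ _ fun i => h i.succ]

variable [SMulCommClass k A M]

theorem map_radPow_le (Φ : M →ₗ[k] M) {U U' : Set A}
    (h : ∀ u ∈ U, ∃ u' ∈ U', ∀ m, Φ (u • m) = u' • Φ m) (j : ℕ) :
    (radPow k A M U j).map Φ ≤ radPow k A M U' j := by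
  simp only [radPow, Submodule.map_iSup]
  refine iSup₂_le fun u hu => ?_
  choose f hfU hf using fun i => h (u i) (hu i)
  refine le_trans ?_ (le_iSup₂_of_le f hfU le_rfl)
  rintro _ ⟨_, ⟨m, rfl⟩, rfl⟩
  exact ⟨Φ m, (prod_smul_intertwine Φ u f hf m).symm⟩

theorem mem_socPow_of_map_mem (Φ : M ≃ₗ[k] M) {U U' : Set A}
    (h : ∀ u ∈ U, ∃ u' ∈ U', ∀ m, Φ (u • m) = u' • Φ m) (j : ℕ) {m : M}
    (hm : Φ m ∈ socPow k A M U' j) : m ∈ socPow k A M U j := by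
  simp only [socPow, Submodule.mem_iInf, LinearMap.mem_ker] at hm ⊢
  intro u hu
  choose f hfU hf using fun i => h (u i) (hu i)
  apply Φ.injective
  rw [map_zero]
  exact (prod_smul_intertwine Φ.toLinearMap u f hf m).trans (hm f hfU)

theorem finrank_radPow_eq_and_finrank_socPow_eq (Φ : M ≃ₗ[k] M) {U U' : Set A}
    (h : ∀ u ∈ U, ∃ u' ∈ U', ∀ m, Φ (u • m) = u' • Φ m)
    (h' : ∀ u' ∈ U', ∃ u ∈ U, ∀ m, Φ.symm (u' • m) = u • Φ.symm m) (j : ℕ) :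
    Module.finrank k (radPow k A M U j) = Module.finrank k (radPow k A M U' j) ∧
    Module.finrank k (socPow k A M U j) = Module.finrank k (socPow k A M U' j) := by
  constructor
  · have : (radPow k A M U j).map Φ.toLinearMap = radPow k A M U' j := by
      refine le_antisymm (map_radPow_le Φ.toLinearMap h j) fun m hm => ?_
      exact ⟨Φ.symm m, map_radPow_le Φ.symm.toLinearMap h' j ⟨m, hm, rfl⟩, by simp⟩
    rw [← this]
    exact (LinearEquiv.finrank_map_eq Φ _).symm
  · have : (socPow k A M U j).map Φ.toLinearMap = socPow k A M U' j := by
      apply le_antisymm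
      · rintro _ ⟨m, hm, rfl⟩
        exact mem_socPow_of_map_mem Φ.symm h' j (by simpa using hm)
      · intro m hm
        exact ⟨Φ.symm m, mem_socPow_of_map_mem Φ h j (by simpa using hm), by simp⟩
    rw [← this]
    exact (LinearEquiv.finrank_map_eq Φ _).symm

theorem finrank_radPow_eq_and_finrank_socPow_eq_of_smul_eq_zero {U U' : Set A}
    (h0 : 0 ∈ U) (h0' : 0 ∈ U') (h : ∀ u ∈ U, ∀ m : M, u • m = 0)
    (h' : ∀ u ∈ U', ∀ m : M, u • m = 0) (j : ℕ) :
    Module.finrank k (radPow k A M U j) = Module.finrank k (radPow k A M U' j) ∧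
    Module.finrank k (socPow k A M U j) = Module.finrank k (socPow k A M U' j) :=
  finrank_radPow_eq_and_finrank_socPow_eq (LinearEquiv.refl k M)
    (fun u hu => ⟨0, h0', fun m => by simp [h u hu]⟩)
    (fun u hu => ⟨0, h0, fun m => by simp [h' u hu]⟩) j

end Intertwining

section LinearAlgebra

variable {V W : Type*} [AddCommGroup V] [Module k V] [AddCommGroup W] [Module k W]

theorem exists_linearEquiv_map_eq [FiniteDimensional k V] (S T : Submodule k V)
    (h : Module.finrank k S = Module.finrank k T) :
    ∃ g : V ≃ₗ[k] V, S.map g.toLinearMap = T := by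
  obtain ⟨S', hS⟩ := S.exists_isCompl
  obtain ⟨T', hT⟩ := T.exists_isCompl
  have h' : Module.finrank k S' = Module.finrank k T' := by
    have := Submodule.finrank_add_eq_of_isCompl hS
    have := Submodule.finrank_add_eq_of_isCompl hT
    omega
  let e := LinearEquiv.ofFinrankEq S T h
  let e' := LinearEquiv.ofFinrankEq S' T' h'
  let g : V ≃ₗ[k] V := (Submodule.prodEquivOfIsCompl S S' hS).symm ≪≫ₗ
    (e.prodCongr e') ≪≫ₗ Submodule.prodEquivOfIsCompl T T' hT
  have hg : ∀ s : S, g s = e s := fun s => by simp [g]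
  refine ⟨g, le_antisymm ?_ fun t ht => ?_⟩
  · rintro _ ⟨s, hs, rfl⟩
    exact (hg ⟨s, hs⟩).symm ▸ (e ⟨s, hs⟩).2
  · exact ⟨e.symm ⟨t, ht⟩, (e.symm ⟨t, ht⟩).2, (hg _).trans (by simp)⟩

theorem exists_submodule_map_eq_finrank_eq (φ : V →ₗ[k] W) (U : Submodule k W)
    (hU : U ≤ LinearMap.range φ) :
    ∃ S : Submodule k V, S.map φ = U ∧ Module.finrank k S = Module.finrank k U := by
  obtain ⟨s, hs⟩ := φ.rangeRestrict.exists_rightInverse_of_surjective φ.range_rangeRestrict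
  have hs' : ∀ w, φ (s w) = w := fun w => congrArg Subtype.val (LinearMap.congr_fun hs w)
  let t := s ∘ₗ Submodule.inclusion hU
  have ht : ∀ u, φ (t u) = u := fun u => hs' _
  refine ⟨LinearMap.range t, ?_, LinearMap.finrank_range_of_inj fun a b hab => ?_⟩
  · ext w
    constructor
    · rintro ⟨_, ⟨u, rfl⟩, rfl⟩
      exact (ht u).symm ▸ u.2
    · exact fun hw => ⟨t ⟨w, hw⟩, ⟨_, rfl⟩, ht _⟩
  · exact Subtype.ext (by rw [← ht a, ← ht b, hab])

end LinearAlgebra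

section Exterior

variable {n : ℕ}

theorem top_mul_extRad_pow_le {i : ℕ} (hi : i ≠ 0) :
    (⊤ : Submodule k (ExteriorAlgebra k (Fin n → k))) * extRad k n ^ i ≤ extRad k n ^ i := by
  obtain ⟨i, rfl⟩ := Nat.exists_eq_succ_of_ne_zero hi
  rw [pow_succ', ← mul_assoc]
  refine mul_le_mul_left ?_ _
  rw [extRad, ← mul_assoc, ← mul_assoc]
  exact mul_le_mul_left (mul_le_mul_left le_top _) _

/-- The automorphism of the exterior algebra induced by a linear automorphism. -/
def extMapEquiv (g : (Fin n → k) ≃ₗ[k] (Fin n → k)) :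
    ExteriorAlgebra k (Fin n → k) ≃ₐ[k] ExteriorAlgebra k (Fin n → k) :=
  AlgEquiv.ofAlgHom (ExteriorAlgebra.map g.toLinearMap) (ExteriorAlgebra.map g.symm.toLinearMap)
    (by rw [ExteriorAlgebra.map_comp_map]; simp) (by rw [ExteriorAlgebra.map_comp_map]; simp)

theorem extMapEquiv_ι (g : (Fin n → k) ≃ₗ[k] (Fin n → k)) (v : Fin n → k) :
    extMapEquiv g (ExteriorAlgebra.ι k v) = ExteriorAlgebra.ι k (g v) :=
  ExteriorAlgebra.map_apply_ι _ _

theorem map_extRad_pow (g : (Fin n → k) ≃ₗ[k] (Fin n → k)) (i : ℕ) :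
    (extRad k n ^ i).map (extMapEquiv g).toAlgHom.toLinearMap = extRad k n ^ i := by
  have htop : (⊤ : Submodule k (ExteriorAlgebra k (Fin n → k))).map
      (extMapEquiv g).toAlgHom.toLinearMap = ⊤ := by
    rw [Submodule.map_top, LinearMap.range_eq_top]
    exact (extMapEquiv g).surjective
  have hι : (LinearMap.range (ExteriorAlgebra.ι k (M := Fin n → k))).map
      (extMapEquiv g).toAlgHom.toLinearMap = LinearMap.range (ExteriorAlgebra.ι k) := by
    apply le_antisymm
    · rintro _ ⟨_, ⟨v, rfl⟩, rfl⟩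
      exact ⟨g v, (extMapEquiv_ι g v).symm⟩
    · rintro _ ⟨v, rfl⟩
      exact ⟨_, ⟨g.symm v, rfl⟩, (extMapEquiv_ι g _).trans (by simp)⟩
  rw [Submodule.map_pow, extRad, Submodule.map_mul, Submodule.map_mul, htop, hι]

theorem extMapEquiv_mem_extRad_pow_iff (g : (Fin n → k) ≃ₗ[k] (Fin n → k)) (i : ℕ)
    (x : ExteriorAlgebra k (Fin n → k)) :
    extMapEquiv g x ∈ extRad k n ^ i ↔ x ∈ extRad k n ^ i := by
  constructor
  · intro hx
    rw [← map_extRad_pow g] at hx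
    obtain ⟨y, hy, hyx⟩ := hx
    exact (extMapEquiv g).injective hyx ▸ hy
  · intro hx
    rw [← map_extRad_pow g]
    exact ⟨x, hx, rfl⟩

/-- The automorphism of `Rad^i(Λ)` induced by a linear automorphism. -/
def extRadPowEquiv (g : (Fin n → k) ≃ₗ[k] (Fin n → k)) (i : ℕ) :
    ↥(extRad k n ^ i) ≃ₗ[k] ↥(extRad k n ^ i) :=
  (extMapEquiv g).toLinearEquiv.ofSubmodules _ _ (map_extRad_pow g i)

theorem coe_extRadPowEquiv (g : (Fin n → k) ≃ₗ[k] (Fin n → k)) (i : ℕ)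
    (w : ↥(extRad k n ^ i)) :
    (extRadPowEquiv g i w : ExteriorAlgebra k (Fin n → k)) = extMapEquiv g w := rfl

/-- The automorphism of `Rad^i(Λ)/Rad^{i+2}(Λ)` induced by a linear automorphism. -/
def extQuotEquiv (g : (Fin n → k) ≃ₗ[k] (Fin n → k)) (i : ℕ) :
    ExtQuot k n i ≃ₗ[k] ExtQuot k n i :=
  Submodule.Quotient.equiv _ _ (extRadPowEquiv g i) (by
    ext x
    constructor
    · rintro ⟨w, hw, rfl⟩
      exact (extMapEquiv_mem_extRad_pow_iff g (i + 2) _).2 hw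
    · intro hx
      refine ⟨(extRadPowEquiv g i).symm x, ?_, by simp⟩
      refine (extMapEquiv_mem_extRad_pow_iff g (i + 2) _).1 ?_
      rw [Submodule.subtype_apply, ← coe_extRadPowEquiv, LinearEquiv.apply_symm_apply]
      exact hx)

theorem extQuotEquiv_extProj (g : (Fin n → k) ≃ₗ[k] (Fin n → k)) (i : ℕ)
    (w : ↥(extRad k n ^ i)) :
    extQuotEquiv g i (extProj k n i w) = extProj k n i (extRadPowEquiv g i w) := rfl

end Exterior

section Action

variable {p n : ℕ}

theorem xGen_pow_eq_zero (t : Fin n) : xGen k n p t ^ p = 0 := by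
  rw [xGen, ← map_pow, Ideal.Quotient.eq_zero_iff_mem]
  exact Ideal.subset_span ⟨t, rfl⟩

/-- The linear form `∑ vₜ xₜ` with coefficient vector `v`. -/
def linearForm (k : Type*) [Field k] (n p : ℕ) : (Fin n → k) →ₗ[k] TruncAlg k n p :=
  Fintype.linearCombination k (xGen k n p)

theorem linearForm_apply (v : Fin n → k) : linearForm k n p v = ∑ t, v t • xGen k n p t :=
  Fintype.linearCombination_apply ..

theorem range_linearForm : LinearMap.range (linearForm k n p) = xSpan k n p :=
  Fintype.range_linearCombination k _

theorem xSpan_smul_extQuot_zero [Module (TruncAlg k n p) (ExtQuot k n 0)]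
    [IsScalarTower k (TruncAlg k n p) (ExtQuot k n 0)]
    {u : TruncAlg k n p} (hu : u ∈ xSpan k n p) (m : ExtQuot k n 0) : u • m = 0 := by
  have key : ∃ m₀ : ExtQuot k n 0, ∀ m, ∃ c : k, m = c • m₀ := by
    have h1 : (1 : ExteriorAlgebra k (Fin n → k)) ∈ extRad k n ^ 0 := by
      rw [pow_zero]; exact Submodule.one_le.1 le_rfl
    refine ⟨extProj k n 0 ⟨1, h1⟩, fun m => ?_⟩
    obtain ⟨⟨w, hw⟩, rfl⟩ := Submodule.mkQ_surjective _ m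
    have hw' := hw
    rw [pow_zero, Submodule.mem_one] at hw'
    obtain ⟨c, rfl⟩ := hw'
    refine ⟨c, ?_⟩
    rw [← map_smul]
    exact congrArg _ (Subtype.ext (Algebra.algebraMap_eq_smul_one c))
  obtain ⟨m₀, hm₀⟩ := key
  have hx : ∀ t, xGen k n p t • m₀ = 0 := fun t =>
    smul_eq_zero_of_pow_eq_zero (xGen_pow_eq_zero t) (hm₀ _)
  obtain ⟨c, rfl⟩ := hm₀ m
  rw [← range_linearForm] at hu
  obtain ⟨v, rfl⟩ := hu
  rw [smul_comm, linearForm_apply, Finset.sum_smul]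
  simp [smul_assoc, hx]

theorem linearForm_smul_extProj {i : ℕ} (hi : i ≠ 0)
    [Module (TruncAlg k n p) (ExtQuot k n i)]
    [IsScalarTower k (TruncAlg k n p) (ExtQuot k n i)]
    (haction : ∀ (t : Fin n) (w w' : ↥((extRad k n) ^ i)),
      (w' : ExteriorAlgebra k (Fin n → k)) =
          ExteriorAlgebra.ι k (Pi.single t (1 : k)) * (w : ExteriorAlgebra k (Fin n → k)) →
        xGen k n p t • extProj k n i w = extProj k n i w')
    (v : Fin n → k) (w w' : ↥((extRad k n) ^ i))
    (hw : (w' : ExteriorAlgebra k (Fin n → k)) = ExteriorAlgebra.ι k v * w) :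
    linearForm k n p v • extProj k n i w = extProj k n i w' := by
  have hmem : ∀ t : Fin n, ExteriorAlgebra.ι k (Pi.single t (1 : k)) *
      (w : ExteriorAlgebra k (Fin n → k)) ∈ extRad k n ^ i := fun t =>
    top_mul_extRad_pow_le hi (Submodule.mul_mem_mul Submodule.mem_top w.2)
  have hsum : w' = ∑ t, v t • (⟨_, hmem t⟩ : ↥((extRad k n) ^ i)) := by
    apply Subtype.ext
    rw [hw]
    conv_lhs => rw [pi_eq_sum_univ' v]
    simp [Finset.sum_mul]
  rw [hsum, map_sum, linearForm_apply, Finset.sum_smul]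
  refine Finset.sum_congr rfl fun t _ => ?_
  rw [smul_assoc, map_smul, haction t w ⟨_, hmem t⟩ rfl]

theorem extQuotEquiv_linearForm_smul {i : ℕ} (hi : i ≠ 0)
    [Module (TruncAlg k n p) (ExtQuot k n i)]
    [IsScalarTower k (TruncAlg k n p) (ExtQuot k n i)]
    (haction : ∀ (t : Fin n) (w w' : ↥((extRad k n) ^ i)),
      (w' : ExteriorAlgebra k (Fin n → k)) =
          ExteriorAlgebra.ι k (Pi.single t (1 : k)) * (w : ExteriorAlgebra k (Fin n → k)) →
        xGen k n p t • extProj k n i w = extProj k n i w')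
    (g : (Fin n → k) ≃ₗ[k] (Fin n → k)) (v : Fin n → k) (m : ExtQuot k n i) :
    extQuotEquiv g i (linearForm k n p v • m) =
      linearForm k n p (g v) • extQuotEquiv g i m := by
  obtain ⟨w, rfl⟩ := Submodule.mkQ_surjective _ m
  change extQuotEquiv g i (_ • extProj k n i w) = _ • extQuotEquiv g i (extProj k n i w)
  have hmem : ExteriorAlgebra.ι k v * (w : ExteriorAlgebra k (Fin n → k)) ∈ extRad k n ^ i :=
    top_mul_extRad_pow_le hi (Submodule.mul_mem_mul Submodule.mem_top w.2)
  rw [linearForm_smul_extProj hi haction v w ⟨_, hmem⟩ rfl, extQuotEquiv_extProj,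
    extQuotEquiv_extProj]
  refine (linearForm_smul_extProj hi haction _ _ _ ?_).symm
  rw [coe_extRadPowEquiv, coe_extRadPowEquiv, map_mul, extMapEquiv_ι]

end Action

end Helpers

/-- `M = Rad^i(Λ)/Rad^{i+2}(Λ)`, with `xₜ` acting by left exterior multiplication by
`eₜ`, has constant `r`-radical type and constant `r`-socle type for every `1 ≤ r ≤ n`. -/
theorem statement13 {k : Type*} [Field k] [IsAlgClosed k] (p n : ℕ) [Fact p.Prime]
    [CharP k p] (i : ℕ)
    [Module (TruncAlg k n p) (ExtQuot k n i)]
    [IsScalarTower k (TruncAlg k n p) (ExtQuot k n i)]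
    (haction : ∀ (t : Fin n) (w w' : ↥((extRad k n) ^ i)),
      (w' : ExteriorAlgebra k (Fin n → k)) =
          ExteriorAlgebra.ι k (Pi.single t (1 : k)) * (w : ExteriorAlgebra k (Fin n → k)) →
        xGen k n p t • extProj k n i w = extProj k n i w')
    (r : ℕ) (hr : 1 ≤ r) (hrn : r ≤ n)
    (U U' : Submodule k (TruncAlg k n p))
    (hU : U ≤ xSpan k n p) (hU' : U' ≤ xSpan k n p)
    (hrkU : Module.finrank k U = r) (hrkU' : Module.finrank k U' = r)
    (ℓ : ℕ) (hℓ : 1 ≤ ℓ) :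
    Module.finrank k
        ↥(radPow k (TruncAlg k n p) (ExtQuot k n i) (U : Set (TruncAlg k n p)) ℓ) =
      Module.finrank k
        ↥(radPow k (TruncAlg k n p) (ExtQuot k n i) (U' : Set (TruncAlg k n p)) ℓ) ∧
    Module.finrank k
        ↥(socPow k (TruncAlg k n p) (ExtQuot k n i) (U : Set (TruncAlg k n p)) ℓ) =
      Module.finrank k
        ↥(socPow k (TruncAlg k n p) (ExtQuot k n i) (U' : Set (TruncAlg k n p)) ℓ) := by
  rcases eq_or_ne i 0 with rfl | hi
  · exact finrank_radPow_eq_and_finrank_socPow_eq_of_smul_eq_zero U.zero_mem U'.zero_mem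
      (fun u hu => xSpan_smul_extQuot_zero (hU hu)) (fun u hu => xSpan_smul_extQuot_zero (hU' hu)) ℓ
  · rw [← range_linearForm] at hU hU'
    obtain ⟨S, rfl, hS⟩ := exists_submodule_map_eq_finrank_eq _ U hU
    obtain ⟨T, rfl, hT⟩ := exists_submodule_map_eq_finrank_eq _ U' hU'
    obtain ⟨g, rfl⟩ := exists_linearEquiv_map_eq S T (by omega)
    have hΦ := extQuotEquiv_linearForm_smul hi haction g
    refine finrank_radPow_eq_and_finrank_socPow_eq (extQuotEquiv g i) ?_ ?_ ℓ
    · rintro _ ⟨v, hv, rfl⟩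
      exact ⟨_, ⟨g v, ⟨v, hv, rfl⟩, rfl⟩, hΦ v⟩
    · rintro _ ⟨_, ⟨v, hv, rfl⟩, rfl⟩
      refine ⟨_, ⟨v, hv, rfl⟩, fun m => ?_⟩
      rw [LinearEquiv.symm_apply_eq, hΦ, LinearEquiv.apply_symm_apply]
      rfl

end
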